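/- There exists a constant C > 0 such that for all real numbers k, l with l ≥ 2 and k ≥ l + 7, and every real number v, one has |Γ((k − l + 1)/2 + 3/2 + i v)| · |Γ((k + l − 1)/2 + 3/2 + i v)| ≤ C · (k² + v²)^{3/2} · Γ((k − l + 1)/2) · Γ((k + l − 1)/2). -/

import Mathlib

open Complex

theorem Complex.norm_Gamma_le_Gamma_re {s : ℂ} (hs : 0 < s.re) :
    ‖Complex.Gamma s‖ ≤ Real.Gamma s.re := by
  rw [Complex.Gamma_eq_integral hs, Real.Gamma_eq_integral hs, Complex.GammaIntegral]
  refine (MeasureTheory.norm_integral_le_integral_norm _).trans_eq ?_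
  refine MeasureTheory.setIntegral_congr_fun measurableSet_Ioi fun x hx => ?_
  simp only [norm_mul, Complex.norm_real, Real.norm_eq_abs, Real.abs_exp,
    Complex.norm_cpow_eq_rpow_re_of_pos hx, Complex.sub_re, Complex.one_re]

theorem Real.Gamma_add_three_halves_le {s : ℝ} (hs : 0 < s) :
    Real.Gamma (s + 3 / 2) ≤ (s + 1) ^ (3 / 2 : ℝ) * Real.Gamma s := by
  have hΓ := Real.Gamma_pos_of_pos hs
  have hconv := Real.Gamma_mul_add_mul_le_rpow_Gamma_mul_rpow_Gamma
    (s := s + 1) (t := s + 1 + 1) (a := 1 / 2) (b := 1 / 2)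
    (by positivity) (by positivity) (by norm_num) (by norm_num) (by norm_num)
  rw [show 1 / 2 * (s + 1) + 1 / 2 * (s + 1 + 1) = s + 3 / 2 by ring,
    Real.Gamma_add_one (by positivity : s + 1 ≠ 0), Real.Gamma_add_one hs.ne',
    ← Real.mul_rpow (by positivity) (by positivity)] at hconv
  calc Real.Gamma (s + 3 / 2)
      ≤ (s * Real.Gamma s * ((s + 1) * (s * Real.Gamma s))) ^ (1 / 2 : ℝ) := hconv
    _ ≤ ((s + 1) * Real.Gamma s * ((s + 1) * ((s + 1) * Real.Gamma s))) ^ (1 / 2 : ℝ) := by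
      gcongr <;> linarith
    _ = ((s + 1) ^ (3 : ℝ) * Real.Gamma s ^ (2 : ℝ)) ^ (1 / 2 : ℝ) := by
      norm_cast; ring_nf
    _ = (s + 1) ^ (3 / 2 : ℝ) * Real.Gamma s := by
      rw [Real.mul_rpow (by positivity) (by positivity), ← Real.rpow_mul (by positivity),
        ← Real.rpow_mul hΓ.le]
      norm_num

theorem Complex.norm_Gamma_add_three_halves_le {s k : ℝ} (hs : 0 < s) (hk : s + 1 ≤ k) (v : ℝ) :
    ‖Complex.Gamma (((s + 3 / 2 : ℝ) : ℂ) + (v : ℂ) * Complex.I)‖ ≤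
      k ^ (3 / 2 : ℝ) * Real.Gamma s := by
  have hre : (((s + 3 / 2 : ℝ) : ℂ) + (v : ℂ) * Complex.I).re = s + 3 / 2 := by simp
  have hnorm := Complex.norm_Gamma_le_Gamma_re
    (s := ((s + 3 / 2 : ℝ) : ℂ) + (v : ℂ) * Complex.I) (by rw [hre]; positivity)
  rw [hre] at hnorm
  have hΓ := (Real.Gamma_pos_of_pos hs).le
  exact (hnorm.trans (Real.Gamma_add_three_halves_le hs)).trans (by gcongr)

/-- The displayed estimate at the end of Section 5 of the paper (in a single
archimedean component): the quotient of shifted Gamma factors arising from the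
approximate functional equation on the line `Re(u) = 3/2` is bounded by
`(k² + v²)^{3/2}`. -/
theorem gamma_quotient_end_section5 :
    ∃ C : ℝ, 0 < C ∧ ∀ k l : ℝ, 2 ≤ l → l + 7 ≤ k → ∀ v : ℝ,
      ‖Complex.Gamma ((((k - l + 1) / 2 + 3 / 2 : ℝ) : ℂ) + (v : ℂ) * Complex.I)‖ *
          ‖Complex.Gamma ((((k + l - 1) / 2 + 3 / 2 : ℝ) : ℂ) + (v : ℂ) * Complex.I)‖ ≤
        C * (k ^ 2 + v ^ 2) ^ (3 / 2 : ℝ) *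
          (Real.Gamma ((k - l + 1) / 2) * Real.Gamma ((k + l - 1) / 2)) := by
  refine ⟨1, one_pos, fun k l hl hk v => ?_⟩
  have ha : 0 < (k - l + 1) / 2 := by linarith
  have hb : 0 < (k + l - 1) / 2 := by linarith
  have hk₀ : 0 ≤ k := by linarith
  have hΓa := (Real.Gamma_pos_of_pos ha).le
  have hΓb := (Real.Gamma_pos_of_pos hb).le
  have hpow : k ^ (3 / 2 : ℝ) * k ^ (3 / 2 : ℝ) ≤ (k ^ 2 + v ^ 2) ^ (3 / 2 : ℝ) := by
    rw [← Real.mul_rpow hk₀ hk₀]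
    gcongr
    nlinarith [sq_nonneg v]
  calc _ ≤ (k ^ (3 / 2 : ℝ) * Real.Gamma ((k - l + 1) / 2)) *
        (k ^ (3 / 2 : ℝ) * Real.Gamma ((k + l - 1) / 2)) := by
        gcongr
        · exact Complex.norm_Gamma_add_three_halves_le ha (by linarith) v
        · exact Complex.norm_Gamma_add_three_halves_le hb (by linarith) v
    _ = k ^ (3 / 2 : ℝ) * k ^ (3 / 2 : ℝ) *
        (Real.Gamma ((k - l + 1) / 2) * Real.Gamma ((k + l - 1) / 2)) := by ring
    _ ≤ _ := by
        rw [one_mul]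
        gcongr
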